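/- Fix ε ∈ (0, 1/4). For n with ε < x(n) < 1/2 − ε, set r = ⌊n^{x(n)/2}⌋ and n′ = n + r·a(n). Then for all sufficiently large such n: a(n′) = a(n), and C(n′, a(n)) · 2^{−a(n)(a(n)−1)/2} = μ(n) + o(1); precisely, for every δ > 0 there is N such that for all n ≥ N with ε < x(n) < 1/2 − ε, a(n′) = a(n) and | C(n′, a(n)) · 2^{−a(n)(a(n)−1)/2} − μ(n) | ≤ δ. -/

import Mathlib

open Filter

/-- `α₀(n) = 2 log₂ n − 2 log₂ log₂ n + 2 log₂ (e/2) + 1`. -/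
noncomputable def alpha0 (n : ℕ) : ℝ :=
  2 * Real.logb 2 n - 2 * Real.logb 2 (Real.logb 2 n)
    + 2 * Real.logb 2 (Real.exp 1 / 2) + 1

/-- `a(n) = ⌊α₀(n)⌋`. -/
noncomputable def aa (n : ℕ) : ℕ := ⌊alpha0 n⌋₊

/-- `μ(n) = C(n, a(n)) · 2^{−a(n)(a(n)−1)/2}`. -/
noncomputable def mu (n : ℕ) : ℝ :=
  (n.choose (aa n) : ℝ) * (2 : ℝ)⁻¹ ^ ((aa n).choose 2)

/-- `x(n) = log μ(n) / log n`, so that `μ(n) = n^{x(n)}`. -/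
noncomputable def xx (n : ℕ) : ℝ := Real.log (mu n) / Real.log n


lemma log_fact_le (a : ℕ) (ha : 1 ≤ a) :
    Real.log (a.factorial : ℝ) ≤ 1 + (a + 1) * Real.log a - a := by
  induction a, ha using Nat.le_induction with
  | base => simp
  | succ a ha ih =>
    have h0 : (0:ℝ) < a := by exact_mod_cast ha
    have h1 : (0:ℝ) < (a:ℝ) + 1 := by positivity
    have h2 : (0:ℝ) < (a.factorial : ℝ) := by exact_mod_cast a.factorial_pos
    rw [Nat.factorial_succ]
    push_cast
    rw [Real.log_mul h1.ne' h2.ne']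
    have h3 := Real.one_sub_inv_le_log_of_pos (div_pos h1 h0)
    rw [Real.log_div h1.ne' h0.ne', inv_div] at h3
    have h4 : ((a:ℝ) + 1) * (1 - a / (a + 1)) = 1 := by field_simp; ring
    have h5 := mul_le_mul_of_nonneg_left h3 h1.le
    nlinarith

lemma desc_ratio (n m a k : ℕ) (ha : a ≤ n) (hk : k ≤ a) :
    (n + m).descFactorial k * (n - a) ^ k ≤ n.descFactorial k * (n - a + m) ^ k := by
  induction k with
  | zero => simp
  | succ k ih =>
    have ih := ih (by omega)
    rw [Nat.descFactorial_succ, Nat.descFactorial_succ, pow_succ, pow_succ]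
    obtain ⟨d, rfl⟩ : ∃ d, n = a + d := ⟨n - a, by omega⟩
    obtain ⟨t, rfl⟩ : ∃ t, a = k + t := ⟨a - k, by omega⟩
    have e1 : k + t + d + m - k = t + d + m := by omega
    have e2 : k + t + d - k = t + d := by omega
    have e3 : k + t + d - (k + t) = d := by omega
    rw [e3] at ih
    rw [e1, e2, e3]
    have h : (t + d + m) * d ≤ (t + d) * (d + m) := by nlinarith [Nat.zero_le (t * m)]
    calc _ = ((k + t + d + m).descFactorial k * d ^ k) * ((t + d + m) * d) := by ring
      _ ≤ ((k + t + d).descFactorial k * (d + m) ^ k) * ((t + d) * (d + m)) :=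
        Nat.mul_le_mul ih h
      _ = _ := by ring

lemma choose_ratio (n m a : ℕ) (ha : a < n) :
    ((n + m).choose a : ℝ) ≤ n.choose a * Real.exp (a * (m / ((n:ℝ) - a))) := by
  have h := desc_ratio n m a a ha.le le_rfl
  rw [Nat.descFactorial_eq_factorial_mul_choose, Nat.descFactorial_eq_factorial_mul_choose,
    mul_assoc, mul_assoc] at h
  have h := Nat.le_of_mul_le_mul_left h a.factorial_pos
  have h' : ((n + m).choose a : ℝ) * ((n:ℝ) - a) ^ a ≤ n.choose a * ((n:ℝ) - a + m) ^ a := by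
    have := (Nat.cast_le (α := ℝ)).2 h
    push_cast [Nat.cast_sub ha.le] at this
    exact this
  have hd : (0:ℝ) < (n:ℝ) - a := by
    have : (a:ℝ) < n := by exact_mod_cast ha
    linarith
  have h1 : ((n:ℝ) - a + m) ^ a ≤ ((n:ℝ) - a) ^ a * Real.exp (a * (m / ((n:ℝ) - a))) := by
    rw [Real.exp_nat_mul, ← mul_pow]
    have : (0:ℝ) ≤ m := by positivity
    apply pow_le_pow_left₀ (by positivity)
    have h2 := Real.add_one_le_exp ((m:ℝ) / ((n:ℝ) - a))
    have h3 := mul_le_mul_of_nonneg_left h2 hd.le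
    have h4 : ((n:ℝ) - a) * ((m:ℝ) / ((n:ℝ) - a) + 1) = (n:ℝ) - a + m := by
      field_simp; ring
    linarith
  have h2 : (0:ℝ) < ((n:ℝ) - a) ^ a := by positivity
  have h3 : (0:ℝ) ≤ n.choose a := by positivity
  refine le_of_mul_le_mul_right ?_ h2
  calc _ ≤ _ := h'
    _ ≤ _ := mul_le_mul_of_nonneg_left h1 h3
    _ = _ := by ring

lemma alpha0_eq (n : ℕ) : alpha0 n * Real.log 2 =
    2 * Real.log n - 2 * Real.log (Real.log n / Real.log 2) + 2 - Real.log 2 := by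
  have hc : Real.log 2 ≠ 0 := (Real.log_pos (by norm_num)).ne'
  unfold alpha0 Real.logb
  rw [Real.log_div (Real.exp_pos 1).ne' (by norm_num), Real.log_exp]
  field_simp
  ring

lemma ev (K : ℝ) (hK : 0 < K) : ∀ᶠ n : ℕ in atTop, 10 ≤ Real.log n ∧
    2 + Real.log (2 * (Real.log n / Real.log 2)) ≤ Real.log n / 16 ∧
    K * (2 * (Real.log n / Real.log 2)) ^ 2 ≤ (n:ℝ) ^ (1/4 : ℝ) := by
  have hc : 0 < Real.log 2 := Real.log_pos (by norm_num)
  have hl : Tendsto (fun n : ℕ => Real.log (n:ℝ)) atTop atTop :=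
    Real.tendsto_log_atTop.comp tendsto_natCast_atTop_atTop
  have h1 := hl.eventually_ge_atTop 10
  have h2 : ∀ᶠ l : ℝ in atTop, 2 + Real.log (2 * (l / Real.log 2)) ≤ l / 16 := by
    have := Real.isLittleO_log_id_atTop.bound (show (0:ℝ) < 1/32 by norm_num)
    filter_upwards [this, eventually_ge_atTop (1:ℝ),
      eventually_ge_atTop (32 * (2 + Real.log (2 / Real.log 2)))] with l h h1 h2
    have e : 2 * (l / Real.log 2) = (2 / Real.log 2) * l := by ring
    rw [e, Real.log_mul (by positivity) (by positivity)]
    simp only [Real.norm_eq_abs, id] at h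
    rw [abs_of_pos (by linarith : (0:ℝ) < l)] at h
    have := le_abs_self (Real.log l)
    linarith
  have h3 : ∀ᶠ x : ℝ in atTop, K * (2 * (Real.log x / Real.log 2)) ^ 2 ≤ x ^ (1/4 : ℝ) := by
    set M : ℝ := K * (2 / Real.log 2) ^ 2 with hM
    have hMp : 0 < M := by positivity
    have := (isLittleO_log_rpow_atTop (show (0:ℝ) < 1/8 by norm_num)).bound
      (show (0:ℝ) < 1 / (1 + M) by positivity)
    filter_upwards [this, eventually_ge_atTop (1:ℝ)] with x h hx
    have hl0 := Real.log_nonneg hx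
    have hx0 : (0:ℝ) ≤ x ^ (1/8 : ℝ) := by positivity
    rw [Real.norm_eq_abs, Real.norm_eq_abs, abs_of_nonneg hl0, abs_of_nonneg hx0] at h
    have e : x ^ (1/4 : ℝ) = (x ^ (1/8 : ℝ)) ^ 2 := by
      rw [← Real.rpow_natCast, ← Real.rpow_mul (by linarith)]; norm_num
    rw [e]
    have h5 : Real.log x ^ 2 ≤ (1 / (1 + M) * x ^ (1/8 : ℝ)) ^ 2 := pow_le_pow_left₀ hl0 h 2
    have h6 : M * (1 / (1 + M)) ^ 2 ≤ 1 := by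
      rw [one_div, inv_pow, ← div_eq_mul_inv, div_le_one (by positivity)]
      nlinarith
    calc _ = M * Real.log x ^ 2 := by rw [hM]; ring
      _ ≤ M * (1 / (1 + M) * x ^ (1/8 : ℝ)) ^ 2 := mul_le_mul_of_nonneg_left h5 hMp.le
      _ = (M * (1 / (1 + M)) ^ 2) * (x ^ (1/8 : ℝ)) ^ 2 := by ring
      _ ≤ 1 * (x ^ (1/8 : ℝ)) ^ 2 := mul_le_mul_of_nonneg_right h6 (by positivity)
      _ = _ := one_mul _
  filter_upwards [h1, hl.eventually h2, tendsto_natCast_atTop_atTop.eventually h3] with n a b c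
  exact ⟨a, b, c⟩

lemma basic (n : ℕ) (h1 : 10 ≤ Real.log n)
    (h2 : 2 + Real.log (2 * (Real.log n / Real.log 2)) ≤ Real.log n / 16) :
    (aa n : ℝ) ≤ alpha0 n ∧ alpha0 n < aa n + 1 ∧
    (aa n : ℝ) ≤ 2 * (Real.log n / Real.log 2) ∧ 3 / 2 * Real.log n ≤ aa n * Real.log 2 ∧
    1 ≤ aa n := by
  have hc1 := Real.log_two_gt_d9
  have hc2 := Real.log_two_lt_d9
  have hc : 0 < Real.log 2 := by linarith
  have he := alpha0_eq n
  have hLl : Real.log n ≤ Real.log n / Real.log 2 := by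
    rw [le_div_iff₀ hc]; nlinarith
  have hL1 : 1 ≤ Real.log (Real.log n / Real.log 2) := by
    rw [Real.le_log_iff_exp_le (by linarith)]
    have := Real.exp_one_lt_d9
    linarith
  rw [Real.log_mul (by norm_num) (by linarith)] at h2
  set l := Real.log n
  set c := Real.log 2
  set q := Real.log (l / c)
  have hp : 0 ≤ alpha0 n := by
    by_contra hh
    push Not at hh
    nlinarith
  have f1 : (aa n : ℝ) ≤ alpha0 n := Nat.floor_le hp
  have f2 : alpha0 n < aa n + 1 := Nat.lt_floor_add_one _
  have f4 : 3 / 2 * l ≤ aa n * c := by nlinarith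
  refine ⟨f1, f2, ?_, f4, ?_⟩
  · rw [← mul_div_assoc, le_div_iff₀ hc]
    nlinarith
  · by_contra hh
    have : aa n = 0 := by omega
    rw [this] at f4
    simp at f4
    linarith

lemma mu_lower (n : ℕ) (h1 : 10 ≤ Real.log n)
    (h2 : 2 + Real.log (2 * (Real.log n / Real.log 2)) ≤ Real.log n / 16)
    (hn : (aa n : ℝ) ^ 2 + aa n ≤ n) (hth : aa n + 3 / 4 ≤ alpha0 n) :
    1 / 2 * Real.log n ≤ Real.log (mu n) := by
  obtain ⟨f1, f2, f3, f4, f5⟩ := basic n h1 h2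
  have he := alpha0_eq n
  have hc : 0 < Real.log 2 := Real.log_pos (by norm_num)
  unfold mu
  set a := aa n with ha
  have ha1 : (1:ℝ) ≤ a := by exact_mod_cast f5
  have hna : (a:ℝ) ^ 2 ≤ (n:ℝ) - a := by linarith
  have hd : (0:ℝ) < (n:ℝ) - a := by nlinarith
  have hlt : a < n := by
    have : (a:ℝ) < n := by linarith
    exact_mod_cast this
  have hn0 : (0:ℝ) < n := by linarith
  have hch : (0:ℝ) < n.choose a := by exact_mod_cast Nat.choose_pos hlt.le
  have hfa : (0:ℝ) < a.factorial := by exact_mod_cast a.factorial_pos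
  rw [Real.log_mul hch.ne' (by positivity), Real.log_pow, Real.log_inv, Nat.cast_choose_two]
  -- choose lower bound
  have g1 : ((n:ℝ) - a) ^ a ≤ a.factorial * n.choose a := by
    have h := Nat.pow_sub_le_descFactorial n a
    rw [Nat.descFactorial_eq_factorial_mul_choose] at h
    have h' : ((n + 1 - a : ℕ) : ℝ) ^ a ≤ a.factorial * n.choose a := by exact_mod_cast h
    refine le_trans (pow_le_pow_left₀ hd.le ?_ a) h'
    rw [Nat.cast_sub (by omega)]; push_cast; linarith
  have g2 := Real.log_le_log (by positivity) g1
  rw [Real.log_pow, Real.log_mul hfa.ne' hch.ne'] at g2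
  have g3 := log_fact_le a f5
  have g4 : Real.log n - a / ((n:ℝ) - a) ≤ Real.log ((n:ℝ) - a) := by
    have := Real.one_sub_inv_le_log_of_pos (div_pos hd hn0)
    rw [Real.log_div hd.ne' hn0.ne', inv_div] at this
    have e : 1 - (n:ℝ) / (n - a) = - (a / ((n:ℝ) - a)) := by field_simp; ring
    linarith
  have g5 : (a:ℝ) * (a / ((n:ℝ) - a)) ≤ 1 := by
    rw [← mul_div_assoc, div_le_one hd]; nlinarith
  have g6 : (a:ℝ) * Real.log n - 1 ≤ a * Real.log ((n:ℝ) - a) := by nlinarith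
  have g7 : Real.log a ≤ Real.log (2 * (Real.log n / Real.log 2)) :=
    Real.log_le_log (by linarith) f3
  have g8 : Real.log (2 * (Real.log n / Real.log 2)) =
      Real.log 2 + Real.log (Real.log n / Real.log 2) :=
    Real.log_mul (by norm_num) (by positivity)
  have g9 : (a:ℝ) * Real.log 2 + 3/4 * Real.log 2 ≤
      2 * Real.log n - 2 * Real.log (Real.log n / Real.log 2) + 2 - Real.log 2 := by nlinarith
  set l := Real.log n
  set c := Real.log 2
  set q := Real.log (l / c)
  set s := Real.log (a:ℝ)
  have k1 : (a:ℝ) * (((a:ℝ) - 1) / 2 * c) ≤ a * (l - q + 1 - c - 3 / 8 * c) :=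
    mul_le_mul_of_nonneg_left (by nlinarith) (by linarith)
  have k2 : (a:ℝ) * s ≤ a * (c + q) := mul_le_mul_of_nonneg_left (by linarith) (by linarith)
  nlinarith

lemma alpha0_diff (n n' : ℕ) (h : n ≤ n') (h1 : 10 ≤ Real.log n)
    (hn : (n':ℝ) ≤ n + n / 16) : alpha0 n ≤ alpha0 n' ∧ alpha0 n' ≤ alpha0 n + 1/4 := by
  have hc1 := Real.log_two_gt_d9
  have hc2 := Real.log_two_lt_d9
  have hc : 0 < Real.log 2 := by linarith
  have e1 := alpha0_eq n
  have e2 := alpha0_eq n'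
  have hn0 : (0:ℝ) < n := by
    rcases Nat.eq_zero_or_pos n with rfl | h
    · simp at h1; linarith
    · exact_mod_cast h
  have hnn : (n:ℝ) ≤ n' := by exact_mod_cast h
  have m1 : Real.log n ≤ Real.log n' := Real.log_le_log hn0 hnn
  have m2 : Real.log n' ≤ Real.log n + 1/16 := by
    have := Real.log_le_sub_one_of_pos (div_pos (hn0.trans_le hnn) hn0)
    rw [Real.log_div (by linarith) hn0.ne'] at this
    have h3 : (n':ℝ) / n ≤ 1 + 1/16 := by
      rw [div_le_iff₀ hn0]; linarith
    linarith
  set l := Real.log n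
  set l' := Real.log n'
  have hl : 0 < l := by linarith
  have hl' : 0 < l' := by linarith
  rw [Real.log_div hl.ne' hc.ne'] at e1
  rw [Real.log_div hl'.ne' hc.ne'] at e2
  have m3 : Real.log l ≤ Real.log l' := Real.log_le_log hl m1
  have m4 : Real.log l' ≤ Real.log l + (l' - l) := by
    have := Real.log_le_sub_one_of_pos (div_pos hl' hl)
    rw [Real.log_div hl'.ne' hl.ne'] at this
    have h3 : l' / l ≤ 1 + (l' - l) := by
      rw [div_le_iff₀ hl]; nlinarith
    linarith
  constructor
  · refine le_of_mul_le_mul_right ?_ hc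
    linarith
  · refine le_of_mul_le_mul_right ?_ hc
    linarith

set_option maxHeartbeats 1000000 in
/-- For large `n` with `ε < x(n) < 1/2 − ε`, setting `r = ⌊n^{x(n)/2}⌋` and
`n′ = n + r·a(n)`: `a(n′) = a(n)` and `C(n′, a(n))·2^{−a(n)(a(n)−1)/2} = μ(n) + o(1)`. -/
theorem stmt16 (ε : ℝ) (hε : 0 < ε) (hε4 : ε < 1/4) :
    ∀ δ > (0:ℝ), ∃ N : ℕ, ∀ n ≥ N, ε < xx n → xx n < 1/2 - ε →
      let r : ℕ := ⌊(n : ℝ) ^ (xx n / 2)⌋₊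
      let n' : ℕ := n + r * aa n
      aa n' = aa n ∧
      |(n'.choose (aa n) : ℝ) * (2 : ℝ)⁻¹ ^ ((aa n).choose 2) - mu n| ≤ δ := by
  intro δ hδ
  set K : ℝ := max 100 (4 / δ) with hKdef
  have hK100 : 100 ≤ K := le_max_left _ _
  have hKδ : 4 / δ ≤ K := le_max_right _ _
  obtain ⟨N, hN⟩ := eventually_atTop.1 (ev K (by linarith))
  refine ⟨N, fun n hn _ hx2 => ?_⟩
  obtain ⟨h1, h2, h3⟩ := hN n hn
  obtain ⟨f1, f2, f3, f4, f5⟩ := basic n h1 h2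
  intro r n'
  have ha1 : (1:ℝ) ≤ aa n := by exact_mod_cast f5
  have hn0 : (0:ℝ) < n := by
    rcases Nat.eq_zero_or_pos n with h0 | h
    · rw [h0] at h1; simp at h1; linarith
    · exact_mod_cast h
  have hn1 : (1:ℝ) ≤ n := by exact_mod_cast (Nat.cast_pos.1 hn0)
  set y : ℝ := (n:ℝ) ^ (1/4 : ℝ) with hy
  have hy4 : y ^ 4 = n := by
    rw [hy, ← Real.rpow_natCast, ← Real.rpow_mul hn0.le]; norm_num
  have hKa : K * (aa n : ℝ) ^ 2 ≤ y := by
    refine le_trans ?_ h3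
    have := pow_le_pow_left₀ (by linarith) f3 2
    exact mul_le_mul_of_nonneg_left this (by linarith)
  have hay : 100 * (aa n : ℝ) ^ 2 ≤ y := le_trans (by nlinarith) hKa
  have hy100 : 100 ≤ y := by nlinarith
  have hr : (r:ℝ) ≤ (n:ℝ) ^ (xx n / 2) := Nat.floor_le (by positivity)
  have hry : (r:ℝ) ≤ y := hr.trans (Real.rpow_le_rpow_of_exponent_le hn1 (by linarith))
  have hr0 : (0:ℝ) ≤ r := by positivity
  have hyy : y ^ 2 * 10000 ≤ n := by
    have hsq : (10000:ℝ) ≤ y ^ 2 := by nlinarith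
    have := mul_le_mul_of_nonneg_left hsq (sq_nonneg y)
    calc y ^ 2 * 10000 ≤ y ^ 2 * y ^ 2 := this
      _ = n := by rw [← hy4]; ring
  have haa : (aa n : ℝ) ≤ (aa n : ℝ) ^ 2 := by nlinarith
  have hA : (aa n : ℝ) ^ 2 + aa n ≤ n := by nlinarith
  have h2a : 2 * (aa n : ℝ) ≤ n := by nlinarith
  have hra : (r:ℝ) * aa n ≤ n / 16 := by
    have : (r:ℝ) * aa n ≤ y * y := mul_le_mul hry (by linarith) (by linarith) (by linarith)
    nlinarith
  have hn'c : (n':ℝ) = n + r * aa n := by simp [n']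
  have hlt : aa n < n := by
    have : (aa n : ℝ) < n := by linarith
    exact_mod_cast this
  have hmu : 0 < mu n := by
    unfold mu
    have hch : (0:ℝ) < n.choose (aa n) := by exact_mod_cast Nat.choose_pos hlt.le
    positivity
  have hxl : xx n * Real.log n = Real.log (mu n) := by
    unfold xx; exact div_mul_cancel₀ _ (by linarith)
  constructor
  · obtain ⟨d1, d2⟩ := alpha0_diff n n' (Nat.le_add_right _ _) h1 (by linarith)
    have hth : alpha0 n < aa n + 3 / 4 := by
      by_contra hh
      push Not at hh
      have hm := mu_lower n h1 h2 hA hh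
      have hl0 : 0 < Real.log n := by linarith
      have hx3 : xx n < 1 / 2 := by linarith
      have hx4 := mul_lt_mul_of_pos_right hx3 hl0
      rw [hxl] at hx4
      exact absurd hm (not_le.2 hx4)
    have : alpha0 n' < aa n + 1 := by linarith
    exact (Nat.floor_eq_iff (by linarith)).2 ⟨by linarith, this⟩
  · have hmux : mu n = (n:ℝ) ^ (xx n) := by
      rw [Real.rpow_def_of_pos hn0, mul_comm, hxl, Real.exp_log hmu]
    have hd : (n:ℝ) / 2 ≤ n - aa n := by linarith
    set s : ℝ := aa n * ((r * aa n : ℕ) / ((n:ℝ) - aa n)) with hs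
    have hs0 : 0 ≤ s := by
      have : (0:ℝ) ≤ (n:ℝ) - aa n := by linarith
      positivity
    have hs1 : s ≤ 2 * (r * (aa n : ℝ) ^ 2) / n := by
      have e : s = (r * (aa n : ℝ) ^ 2) / ((n:ℝ) - aa n) := by
        rw [hs]; push_cast; ring
      have e2 : 2 * (r * (aa n : ℝ) ^ 2) / n = (r * (aa n : ℝ) ^ 2) / ((n:ℝ) / 2) := by
        field_simp
      rw [e, e2]
      exact div_le_div_of_nonneg_left (by positivity) (by linarith) hd
    have hs2 : s ≤ 1 := by
      refine hs1.trans ?_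
      rw [div_le_one hn0]
      have : (r:ℝ) * (aa n : ℝ) ^ 2 ≤ y * y :=
        mul_le_mul hry (by linarith) (by positivity) (by linarith)
      nlinarith
    have hexp : Real.exp s - 1 ≤ 2 * s := by
      have := Real.abs_exp_sub_one_le (x := s) (by rw [abs_of_nonneg hs0]; exact hs2)
      rw [abs_of_nonneg hs0] at this
      exact (le_abs_self _).trans this
    have hmr : mu n * r ≤ y ^ 3 := by
      calc mu n * r ≤ (n:ℝ) ^ (xx n) * (n:ℝ) ^ (xx n / 2) := by
            rw [hmux]; exact mul_le_mul_of_nonneg_left hr (by positivity)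
        _ = (n:ℝ) ^ (xx n + xx n / 2) := (Real.rpow_add hn0 _ _).symm
        _ ≤ (n:ℝ) ^ (3/4 : ℝ) := Real.rpow_le_rpow_of_exponent_le hn1 (by linarith)
        _ = y ^ 3 := by rw [hy, ← Real.rpow_natCast, ← Real.rpow_mul hn0.le]; norm_num
    have hup := choose_ratio n (r * aa n) (aa n) hlt
    have hp : (0:ℝ) < (2:ℝ)⁻¹ ^ ((aa n).choose 2) := by positivity
    have hup2 : (n'.choose (aa n) : ℝ) * (2 : ℝ)⁻¹ ^ ((aa n).choose 2) ≤ mu n * Real.exp s := by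
      have := mul_le_mul_of_nonneg_right hup hp.le
      unfold mu
      calc _ ≤ _ := this
        _ = _ := by rw [hs]; ring
    have hlow : mu n ≤ (n'.choose (aa n) : ℝ) * (2 : ℝ)⁻¹ ^ ((aa n).choose 2) := by
      unfold mu
      have : (n.choose (aa n) : ℝ) ≤ n'.choose (aa n) := by
        exact_mod_cast Nat.choose_le_choose _ (Nat.le_add_right _ _)
      exact mul_le_mul_of_nonneg_right this hp.le
    rw [abs_of_nonneg (by linarith)]
    have q1 : mu n * (2 * s) ≤ δ := by
      have q2 : mu n * (2 * s) ≤ 4 * (y ^ 3 * (aa n : ℝ) ^ 2) / n := by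
        calc mu n * (2 * s) ≤ mu n * (2 * (2 * (r * (aa n : ℝ) ^ 2) / n)) := by
              apply mul_le_mul_of_nonneg_left _ hmu.le; linarith
          _ = 4 * ((mu n * r) * (aa n : ℝ) ^ 2) / n := by ring
          _ ≤ _ := by gcongr
      refine q2.trans ?_
      rw [div_le_iff₀ hn0, ← hy4]
      have q3 : 4 ≤ K * δ := by rwa [div_le_iff₀ hδ] at hKδ
      have q4 : 4 * (aa n : ℝ) ^ 2 ≤ δ * y := by
        have := mul_le_mul_of_nonneg_left hKa hδ.le
        nlinarith [mul_le_mul_of_nonneg_right q3 (sq_nonneg (aa n : ℝ))]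
      have := mul_le_mul_of_nonneg_left q4 (by positivity : (0:ℝ) ≤ y ^ 3)
      nlinarith
    have := mul_le_mul_of_nonneg_left hexp hmu.le
    linarith
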